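/- Let R be a commutative Noetherian local ring and let M and N be nonzero finitely generated R-modules. If Ext_R^i(M,N) = 0 for all 1 ≤ i ≤ depth(N), then Hom_R(M,N) ≠ 0 and depth(Hom_R(M,N)) = depth(N). -/

import Mathlib

open CategoryTheory

noncomputable section

/-- The `i`-th Ext module of two `R`-modules. -/
def extMod (R : Type) [CommRing R] (i : ℕ) (M N : Type) [AddCommGroup M] [Module R M]
    [AddCommGroup N] [Module R N] : ModuleCat R :=
  ((Ext R (ModuleCat R) i).obj (Opposite.op (ModuleCat.of R M))).obj (ModuleCat.of R N)

/-- The `i`-th Tor module of two `R`-modules. -/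
def torMod (R : Type) [CommRing R] (i : ℕ) (M N : Type) [AddCommGroup M] [Module R M]
    [AddCommGroup N] [Module R N] : ModuleCat R :=
  ((Tor (ModuleCat R) i).obj (ModuleCat.of R M)).obj (ModuleCat.of R N)

/-- The depth of a module over a local ring: the infimum of the set of
indices `i` with `Ext^i(R/𝔪, N) ≠ 0`. -/
def moduleDepth (R : Type) [CommRing R] [IsLocalRing R] (N : Type) [AddCommGroup N]
    [Module R N] : ℕ :=
  sInf {i : ℕ | ¬ Subsingleton (extMod R i (R ⧸ IsLocalRing.maximalIdeal R) N)}

/-- An `R`-module `N` has finite injective dimension iff there is an `n` such that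
`Ext^i(M, N) = 0` for all modules `M` and all `i > n`. -/
def HasFiniteInjDim (R : Type) [CommRing R] (N : Type) [AddCommGroup N] [Module R N] : Prop :=
  ∃ n : ℕ, ∀ (M : Type) [AddCommGroup M] [Module R M], ∀ i : ℕ, n < i →
    Subsingleton (extMod R i M N)

/-- An `R`-module `M` has finite projective dimension iff there is an `n` such that
`Ext^i(M, N) = 0` for all modules `N` and all `i > n`. -/
def HasFiniteProjDim (R : Type) [CommRing R] (M : Type) [AddCommGroup M] [Module R M] : Prop :=
  ∃ n : ℕ, ∀ (N : Type) [AddCommGroup N] [Module R N], ∀ i : ℕ, n < i →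
    Subsingleton (extMod R i M N)

/-- The `𝔪`-torsion submodule `Γ_𝔪(M)` of a module over a local ring. -/
def mTorsion (R : Type) [CommRing R] [IsLocalRing R] (M : Type) [AddCommGroup M]
    [Module R M] : Submodule R M :=
  ⨆ n : ℕ, Submodule.torsionBySet R M ((IsLocalRing.maximalIdeal R ^ n : Ideal R) : Set R)

/-- A semidualizing module: the natural map `R → Hom(C,C)` is bijective and
`Ext^i(C,C) = 0` for all `i ≥ 1`. -/
structure IsSemidualizing (R : Type) [CommRing R] (C : Type) [AddCommGroup C]
    [Module R C] : Prop where
  bijective : Function.Bijective (LinearMap.lsmul R C)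
  ext_vanish : ∀ i : ℕ, 1 ≤ i → Subsingleton (extMod R i C C)

/-- Membership in the Auslander class `A_C(R)`: the natural map `M → Hom(C, C ⊗ M)` is
bijective, `Tor_i(C, M) = 0` and `Ext^i(C, C ⊗ M) = 0` for all `i ≥ 1`. -/
structure MemAuslanderClass (R : Type) [CommRing R] (C : Type) [AddCommGroup C] [Module R C]
    (M : Type) [AddCommGroup M] [Module R M] : Prop where
  bijective : Function.Bijective ((TensorProduct.mk R C M).flip)
  tor_vanish : ∀ i : ℕ, 1 ≤ i → Subsingleton (torMod R i C M)
  ext_vanish : ∀ i : ℕ, 1 ≤ i → Subsingleton (extMod R i C (TensorProduct R C M))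

/-- A module `N` is Tor-rigid if for every finitely generated module `M` and every `i ≥ 1`,
`Tor_i(M, N) = 0` implies `Tor_{i+1}(M, N) = 0`. -/
def IsTorRigid (R : Type) [CommRing R] (N : Type) [AddCommGroup N] [Module R N] : Prop :=
  ∀ (M : Type) [AddCommGroup M] [Module R M], Module.Finite R M →
    ∀ i : ℕ, 1 ≤ i → Subsingleton (torMod R i M N) → Subsingleton (torMod R (i + 1) M N)

/-- The natural map `C ⊗ Hom(M,N) → Hom(M, C ⊗ N)`, sending `c ⊗ φ` to `m ↦ c ⊗ φ m`. -/
def homTensorMap (R : Type) [CommRing R] (C M N : Type) [AddCommGroup C] [Module R C]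
    [AddCommGroup M] [Module R M] [AddCommGroup N] [Module R N] :
    TensorProduct R C (M →ₗ[R] N) →ₗ[R] (M →ₗ[R] TensorProduct R C N) :=
  TensorProduct.lift
    ((LinearMap.llcomp R M N (TensorProduct R C N)).comp (TensorProduct.mk R C N))

open scoped Pointwise

theorem subsingleton_ext_zero_iff (R : Type) [CommRing R] (X : ModuleCat.{0} R)
    (N : Type) [AddCommGroup N] [Module R N] :
    Subsingleton (Abelian.Ext X (ModuleCat.of R N) 0) ↔ Subsingleton (X →ₗ[R] N) :=
  (Abelian.Ext.addEquiv₀.trans ModuleCat.homAddEquiv).subsingleton_congr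

theorem subsingleton_extMod_iff (R : Type) [CommRing R] (i : ℕ) (M N : Type) [AddCommGroup M]
    [Module R M] [AddCommGroup N] [Module R N] :
    Subsingleton (extMod R i M N) ↔
      Subsingleton (Abelian.Ext (ModuleCat.of R M) (ModuleCat.of R N) i) := by
  let P := projectiveResolution (ModuleCat.of R M)
  have key : Subsingleton (extMod R i M N) ↔
      (P.complex.linearYonedaObj R (ModuleCat.of R N)).ExactAt i := by
    rw [HomologicalComplex.exactAt_iff_isZero_homology,
      ← (P.isoExt i (ModuleCat.of R N)).isZero_iff, ModuleCat.isZero_iff_subsingleton]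
    rfl
  rw [key]
  cases i with
  | zero =>
    rw [HomologicalComplex.exactAt_iff' _ 0 0 1 (by simp) (by simp),
      ShortComplex.moduleCat_exact_iff, Abelian.Ext.addEquiv₀.subsingleton_congr]
    let π : P.complex.X 0 ⟶ ModuleCat.of R M := P.π.f 0
    have hπ : P.complex.d 1 0 ≫ π = 0 := P.complex_d_comp_π_f_zero
    have : Epi π := inferInstanceAs (Epi (P.π.f 0))
    constructor
    · intro h
      refine subsingleton_of_forall_eq 0 fun f ↦ ?_
      have hf : P.complex.d 1 0 ≫ π ≫ f = 0 := by
        rw [← Category.assoc, hπ, Limits.zero_comp]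
      obtain ⟨(g : P.complex.X 0 ⟶ ModuleCat.of R N), hg⟩ := h (π ≫ f) hf
      replace hg : P.complex.d 0 0 ≫ g = π ≫ f := hg
      rw [P.complex.shape 0 0 (by simp), Limits.zero_comp] at hg
      rw [← cancel_epi π, ← hg, Limits.comp_zero]
    · intro h f hf
      obtain ⟨l, hl⟩ := Limits.CokernelCofork.IsColimit.desc' P.isColimitCokernelCofork f hf
      refine ⟨0, (map_zero _).trans (Eq.trans ?_ hl)⟩
      rw [h.elim l 0]
      exact Limits.comp_zero.symm
  | succ p =>
    rw [HomologicalComplex.exactAt_iff' _ p (p + 1) (p + 2) (by simp) (by simp),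
      ShortComplex.moduleCat_exact_iff]
    constructor
    · intro h
      refine subsingleton_of_forall_eq 0 fun α ↦ ?_
      obtain ⟨f, hf, rfl⟩ := P.extMk_surjective α (p + 2) rfl
      exact (P.extMk_eq_zero_iff f _ rfl hf p rfl).mpr (h f hf)
    · intro h f hf
      exact (P.extMk_eq_zero_iff f _ rfl hf p rfl).mp (Subsingleton.elim _ _)

section

variable {R : Type} [CommRing R]

theorem shortExact_of_exact_lsmul {N Q : Type} [AddCommGroup N] [Module R N] [AddCommGroup Q]
    [Module R Q] {x : R} (hx : IsSMulRegular N x) (g : N →ₗ[R] Q) (hg : Function.Surjective g)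
    (hex : Function.Exact (LinearMap.lsmul R N x) g) :
    (ModuleCat.shortComplexOfCompEqZero (LinearMap.lsmul R N x) g
      hex.linearMap_comp_eq_zero).ShortExact where
  exact := ModuleCat.shortComplex_exact _ hex
  mono_f := by simpa [ModuleCat.mono_iff_injective] using! hx
  epi_g := by simpa [ModuleCat.epi_iff_surjective] using! hg

/-- If `Ext^i(X, N)` and `Ext^{i+1}(X, N)` vanish, then so does `Ext^i(X, N/xN)`. -/
theorem subsingleton_ext_of_exact_lsmul {N Q : Type} [AddCommGroup N] [Module R N]
    [AddCommGroup Q] [Module R Q] {x : R} (hx : IsSMulRegular N x) (g : N →ₗ[R] Q)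
    (hg : Function.Surjective g) (hex : Function.Exact (LinearMap.lsmul R N x) g)
    (X : ModuleCat.{0} R) (i : ℕ)
    (h0 : Subsingleton (Abelian.Ext X (ModuleCat.of R N) i))
    (h1 : Subsingleton (Abelian.Ext X (ModuleCat.of R N) (i + 1))) :
    Subsingleton (Abelian.Ext X (ModuleCat.of R Q) i) := by
  have hS := shortExact_of_exact_lsmul hx g hg hex
  refine subsingleton_of_forall_eq 0 fun α ↦ ?_
  obtain ⟨β, rfl⟩ := Abelian.Ext.covariant_sequence_exact₃ X hS α rfl (h1.elim _ _)
  rw [h0.elim β 0]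
  exact Abelian.Ext.zero_comp ..

/-- If `x` annihilates `X` and `Ext^i(X, N/xN)` vanishes, then so does `Ext^{i+1}(X, N)`. -/
theorem subsingleton_ext_succ_of_exact_lsmul {N Q : Type} [AddCommGroup N] [Module R N]
    [AddCommGroup Q] [Module R Q] {x : R} (hx : IsSMulRegular N x) (g : N →ₗ[R] Q)
    (hg : Function.Surjective g) (hex : Function.Exact (LinearMap.lsmul R N x) g)
    (X : ModuleCat.{0} R) (hX : x ∈ Module.annihilator R X) (i : ℕ)
    (h : Subsingleton (Abelian.Ext X (ModuleCat.of R Q) i)) :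
    Subsingleton (Abelian.Ext X (ModuleCat.of R N) (i + 1)) := by
  have hS := shortExact_of_exact_lsmul hx g hg hex
  refine subsingleton_of_forall_eq 0 fun α ↦ ?_
  have hα : α.comp (Abelian.Ext.mk₀ (x • 𝟙 (ModuleCat.of R N))) (add_zero _) = 0 := by
    have := Abelian.Ext.postcomp_smul_id_eq_zero_of_mem_annihilator
      (M := ModuleCat.of R N) hX (i + 1)
    exact DFunLike.congr_fun (congrArg AddCommGrpCat.Hom.hom this) α
  obtain ⟨β, hβ⟩ := Abelian.Ext.covariant_sequence_exact₁ X hS α hα rfl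
  rw [← hβ, h.elim β 0]
  exact Abelian.Ext.zero_comp ..

variable [IsLocalRing R]

variable (R) in
/-- The residue field of a local ring, as a module over the ring. -/
abbrev residueModule : ModuleCat.{0} R := ModuleCat.of R (R ⧸ IsLocalRing.maximalIdeal R)

variable (R) in
/-- `n` is the least index `i` for which `Ext^i(R/𝔪, N)` is nonzero. -/
def IsDepth (N : Type) [AddCommGroup N] [Module R N] (n : ℕ) : Prop :=
  IsLeast {i | ¬ Subsingleton (Abelian.Ext (residueModule R) (ModuleCat.of R N) i)} n

theorem IsDepth.moduleDepth_eq {N : Type} [AddCommGroup N] [Module R N] {n : ℕ}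
    (h : IsDepth R N n) : moduleDepth R N = n := by
  simpa only [moduleDepth, subsingleton_extMod_iff] using h.csInf_eq

theorem mem_annihilator_residueModule {x : R} :
    x ∈ Module.annihilator R (residueModule R) ↔ x ∈ IsLocalRing.maximalIdeal R := by
  rw [Ideal.annihilator_quotient]

theorem isDepth_zero_iff {N : Type} [AddCommGroup N] [Module R N] :
    IsDepth R N 0 ↔ Nontrivial (residueModule R →ₗ[R] N) := by
  rw [← not_subsingleton_iff_nontrivial]
  exact ⟨fun h ↦ mt (subsingleton_ext_zero_iff R _ _).mpr h.1,
    fun h ↦ ⟨mt (subsingleton_ext_zero_iff R _ _).mp h, fun _ _ ↦ Nat.zero_le _⟩⟩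

/-- Depth drops by one modulo a regular element of the maximal ideal. -/
theorem isDepth_succ_iff {N Q : Type} [AddCommGroup N] [Module R N]
    [AddCommGroup Q] [Module R Q] {x : R} (hx : IsSMulRegular N x) (g : N →ₗ[R] Q)
    (hg : Function.Surjective g) (hex : Function.Exact (LinearMap.lsmul R N x) g)
    (hxm : x ∈ IsLocalRing.maximalIdeal R) (n : ℕ) :
    IsDepth R N (n + 1) ↔ IsDepth R Q n := by
  have hann := mem_annihilator_residueModule.mpr hxm
  have succ (i : ℕ) := subsingleton_ext_succ_of_exact_lsmul hx g hg hex _ hann i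
  have zero : Subsingleton (Abelian.Ext (residueModule R) (ModuleCat.of R N) 0) :=
    (subsingleton_ext_zero_iff R _ _).mpr (hx.linearMap_subsingleton_of_mem_annihilator hann)
  have step (i : ℕ) := subsingleton_ext_of_exact_lsmul hx g hg hex (residueModule R) i
  have lt_iff (m : ℕ) :
      (∀ i < m, Subsingleton (Abelian.Ext (residueModule R) (ModuleCat.of R Q) i)) ↔
      ∀ i < m + 1, Subsingleton (Abelian.Ext (residueModule R) (ModuleCat.of R N) i) := by
    refine ⟨fun h i hi ↦ ?_, fun h i hi ↦ step i (h i (by omega)) (h (i + 1) (by omega))⟩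
    cases i with
    | zero => exact zero
    | succ i => exact succ i (h i (by omega))
  have isDepth_iff {K : Type} [AddCommGroup K] [Module R K] (m : ℕ) : IsDepth R K m ↔
      (∀ i < m, Subsingleton (Abelian.Ext (residueModule R) (ModuleCat.of R K) i)) ∧
      ¬ ∀ i < m + 1, Subsingleton (Abelian.Ext (residueModule R) (ModuleCat.of R K) i) := by
    constructor
    · intro h
      exact ⟨fun i hi ↦ by_contra fun hc ↦ hi.not_ge (h.2 hc), fun hc ↦ h.1 (hc m (by omega))⟩
    · rintro ⟨h, h'⟩
      refine ⟨fun hc ↦ h' fun i hi ↦ ?_, fun i hi ↦ by_contra fun hc ↦ hi (h i (by omega))⟩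
      obtain hi | rfl := Nat.lt_succ_iff_lt_or_eq.mp hi
      exacts [h i hi, hc]
  rw [isDepth_iff, isDepth_iff, lt_iff, lt_iff]

variable [IsNoetherianRing R]

theorem exists_isDepth (N : Type) [AddCommGroup N] [Module R N] [Module.Finite R N]
    [Nontrivial N] : ∃ n, IsDepth R N n := by
  suffices H : ∀ (P : Submodule R N) (Q : Type) [AddCommGroup Q] [Module R Q] (φ : N →ₗ[R] Q),
      Function.Surjective φ → LinearMap.ker φ = P → Nontrivial Q → ∃ n, IsDepth R Q n from
    H _ N LinearMap.id Function.surjective_id rfl inferInstance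
  intro P
  induction P using WellFoundedGT.induction with
  | ind P ih =>
    intro Q _ _ φ hφ hker _
    have : Module.Finite R Q := Module.Finite.of_surjective φ hφ
    by_cases h : Nontrivial (residueModule R →ₗ[R] Q)
    · exact ⟨0, isDepth_zero_iff.mpr h⟩
    · obtain ⟨x, hann, hx⟩ := IsSMulRegular.subsingleton_linearMap_iff.mp
        (not_nontrivial_iff_subsingleton.mp h)
      have hxm := mem_annihilator_residueModule.mp hann
      have hsurj := Submodule.mkQ_surjective (x • (⊤ : Submodule R Q))
      have hex := LinearMap.exact_lsmul_mkQ_smul_top Q x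
      obtain ⟨n, hn⟩ := ih _ (show P < LinearMap.ker ((x • (⊤ : Submodule R Q)).mkQ ∘ₗ φ) by
        refine lt_of_le_of_ne (hker ▸ LinearMap.ker_le_ker_comp _ _) fun heq ↦ ?_
        obtain ⟨q, hq⟩ := exists_ne (0 : Q)
        obtain ⟨y, rfl⟩ := hφ q
        have hy : x • y ∈ P := by
          rw [heq, LinearMap.mem_ker, LinearMap.comp_apply, map_smul]
          exact (hex _).mpr ⟨φ y, rfl⟩
        rw [← hker, LinearMap.mem_ker, map_smul] at hy
        exact hq (hx (hy.trans (smul_zero x).symm)))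
        (Q ⧸ x • (⊤ : Submodule R Q)) _ (hsurj.comp hφ) rfl
        (by
          rw [Submodule.Quotient.nontrivial_iff, ← Submodule.ideal_span_singleton_smul]
          refine (Submodule.top_ne_ideal_smul_of_le_jacobson_annihilator ?_).symm
          refine le_trans ?_ (IsLocalRing.maximalIdeal_le_jacobson _)
          simpa [Ideal.span_le] using hxm)
      exact ⟨n + 1, (isDepth_succ_iff hx _ hsurj hex hxm n).mpr hn⟩

theorem IsDepth.linearMap {M : Type} [AddCommGroup M] [Module R M] [Module.Finite R M]
    [Nontrivial M] {N : Type} [AddCommGroup N] [Module R N] [Module.Finite R N] {n : ℕ}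
    (hN : IsDepth R N n) (hext : ∀ i, 1 ≤ i → i ≤ n →
      Subsingleton (Abelian.Ext (ModuleCat.of R M) (ModuleCat.of R N) i)) :
    Nontrivial (M →ₗ[R] N) ∧ IsDepth R (M →ₗ[R] N) n := by
  induction n generalizing N with
  | zero =>
    rw [isDepth_zero_iff] at hN ⊢
    obtain ⟨ι, hι⟩ := exists_ne (0 : residueModule R →ₗ[R] N)
    obtain ⟨q, hq⟩ : ∃ q, ι q ≠ 0 := not_forall.mp fun h ↦ hι (LinearMap.ext h)
    obtain ⟨m, π, hπ⟩ : ∃ (m : M) (π : M →ₗ[R] residueModule R), π m ≠ 0 := by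
      by_contra! h
      have : Subsingleton (M →ₗ[R] residueModule R) :=
        subsingleton_of_forall_eq 0 fun π ↦ LinearMap.ext fun m ↦ h m π
      obtain ⟨r, hr, hreg⟩ := IsSMulRegular.subsingleton_linearMap_iff.mp this
      by_cases hrm : r ∈ IsLocalRing.maximalIdeal R
      · have hann := Module.mem_annihilator.mp (mem_annihilator_residueModule.mpr hrm)
        exact one_ne_zero (α := R ⧸ IsLocalRing.maximalIdeal R)
          (hreg ((hann _).trans (hann 0).symm))
      · obtain ⟨m, hm⟩ := exists_ne (0 : M)
        have hu : IsUnit r := by simpa using hrm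
        exact hm (hu.smul_eq_zero.mp (Module.mem_annihilator.mp hr m))
    obtain ⟨u, hu⟩ := Ideal.Quotient.exists_inv hπ
    let Φ : residueModule R →ₗ[R] M →ₗ[R] N :=
      LinearMap.lcomp R N π ∘ₗ LinearMap.compRight R ι ∘ₗ
        LinearMap.mul R (R ⧸ IsLocalRing.maximalIdeal R)
    have hΦ : Φ (q * u) m = ι q := by
      change ι (q * u * π m) = ι q
      rw [mul_assoc, mul_comm u, hu, mul_one]
    refine ⟨⟨Φ (q * u), 0, fun h ↦ hq ?_⟩, ⟨Φ, 0, fun h ↦ hq ?_⟩⟩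
    all_goals rw [← hΦ, h]; rfl
  | succ n ih =>
    have hsub := (subsingleton_ext_zero_iff R _ _).mp
      (by_contra fun hc ↦ (hN.2 hc).not_gt n.succ_pos)
    obtain ⟨x, hann, hx⟩ := IsSMulRegular.subsingleton_linearMap_iff.mp hsub
    have hxm := mem_annihilator_residueModule.mp hann
    let g := (x • (⊤ : Submodule R N)).mkQ
    have hg : Function.Surjective g := Submodule.mkQ_surjective _
    have hex : Function.Exact (LinearMap.lsmul R N x) g :=
      LinearMap.exact_lsmul_mkQ_smul_top N x
    obtain ⟨hnt, hdepth⟩ := ih ((isDepth_succ_iff hx g hg hex hxm n).mp hN)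
      fun i h1 hi ↦ subsingleton_ext_of_exact_lsmul hx g hg hex _ i
        (hext i h1 (by omega)) (hext (i + 1) (by omega) (by omega))
    have hsurj : Function.Surjective (LinearMap.compRight R (M := M) g) := by
      intro φ
      have hS := shortExact_of_exact_lsmul hx g hg hex
      have := hext 1 le_rfl (by omega)
      obtain ⟨β, hβ⟩ := Abelian.Ext.covariant_sequence_exact₃ (ModuleCat.of R M) hS
        (Abelian.Ext.mk₀ (ModuleCat.ofHom φ)) rfl (this.elim _ _)
      obtain ⟨ψ, rfl⟩ := Abelian.Ext.addEquiv₀.symm.surjective β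
      refine ⟨ψ.hom, ?_⟩
      rw [Abelian.Ext.addEquiv₀_symm_apply, Abelian.Ext.mk₀_comp_mk₀] at hβ
      exact congrArg ModuleCat.Hom.hom (Abelian.Ext.addEquiv₀.symm.injective hβ)
    have hexact : Function.Exact (LinearMap.lsmul R (M →ₗ[R] N) x)
        (LinearMap.compRight R (M := M) g) := by
      intro φ
      constructor
      · intro hφ
        let e := LinearEquiv.ofInjective (LinearMap.lsmul R N x) hx
        have hmem (m : M) : φ m ∈ LinearMap.range (LinearMap.lsmul R N x) :=
          (hex _).mp (LinearMap.congr_fun hφ m)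
        refine ⟨e.symm ∘ₗ φ.codRestrict _ hmem, LinearMap.ext fun m ↦ ?_⟩
        exact congrArg Subtype.val (e.apply_symm_apply ⟨φ m, hmem m⟩)
      · rintro ⟨ψ, rfl⟩
        exact LinearMap.ext fun m ↦ hex.apply_apply_eq_zero (ψ m)
    have hreg : IsSMulRegular (M →ₗ[R] N) x := fun φ ψ h ↦
      LinearMap.ext fun m ↦ hx (LinearMap.congr_fun h m)
    exact ⟨hsurj.nontrivial, (isDepth_succ_iff hreg _ hsurj hexact hxm n).mpr hdepth⟩

end

theorem hom_nonzero_and_depth_eq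
    (R : Type) [CommRing R] [IsNoetherianRing R] [IsLocalRing R]
    (M N : Type) [AddCommGroup M] [Module R M] [AddCommGroup N] [Module R N]
    [Module.Finite R M] [Module.Finite R N] [Nontrivial M] [Nontrivial N]
    (hext : ∀ i : ℕ, 1 ≤ i → i ≤ moduleDepth R N → Subsingleton (extMod R i M N)) :
    Nontrivial (M →ₗ[R] N) ∧ moduleDepth R (M →ₗ[R] N) = moduleDepth R N := by
  obtain ⟨n, hn⟩ := exists_isDepth (R := R) N
  rw [hn.moduleDepth_eq] at hext ⊢
  obtain ⟨hnt, hdepth⟩ := hn.linearMap (M := M) fun i h1 hi ↦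
    (subsingleton_extMod_iff R i M N).mp (hext i h1 hi)
  exact ⟨hnt, hdepth.moduleDepth_eq⟩
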